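/- arXiv:cs/0312001 — 3 statements merged into one kernel-verified Lean document; each statement's English description precedes it below -/
import Mathlib

section
/- Every well-founded graph depicts exactly one well-founded set: let α be a type (of size at most that of the set-theoretic universe's index universe) and E : α → α → Prop a relation, where E x y means that y is a child of x. If the converse relation (fun y x => E x y) is well-founded, then there exists exactly one ZFSet-decoration of (α, E), i.e. exactly one function d : α → ZFSet such that for every x : α and every set z, z ∈ d x if and only if z = d y for some y with E x y. -/
universe u

/-- `d` is a `ZFSet`-decoration of the graph `(α, E)`: for every node `x`,
the members of `d x` are exactly the sets `d y` for children `y` of `x`. -/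
def IsZFSetDecoration {α : Type u} (E : α → α → Prop) (d : α → ZFSet.{u}) : Prop :=
  ∀ x : α, ∀ z : ZFSet.{u}, z ∈ d x ↔ ∃ y : α, E x y ∧ z = d y

/-- Every well-founded graph depicts exactly one well-founded set: if the
converse of the child relation `E` is well-founded, then `(α, E)` has exactly
one `ZFSet`-decoration. -/
theorem wellfounded_graph_unique_decoration {α : Type u} (E : α → α → Prop)
    (hwf : WellFounded (fun y x => E x y)) :
    ∃! d : α → ZFSet.{u}, IsZFSetDecoration E d := by
  let d : α → ZFSet.{u} :=
    hwf.fix fun x rec => ZFSet.range fun y : {y : α // E x y} => rec y.1 y.2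
  have hd : IsZFSetDecoration E d := by
    intro x z
    have hx : d x = ZFSet.range fun y : {y : α // E x y} => d y.1 := hwf.fix_eq _ x
    rw [hx, ZFSet.mem_range]
    exact ⟨fun ⟨y, hy⟩ => ⟨y.1, y.2, hy.symm⟩, fun ⟨y, hxy, hz⟩ => ⟨⟨y, hxy⟩, hz.symm⟩⟩
  refine ⟨d, hd, fun e he => funext fun x => ?_⟩
  induction x using hwf.induction with
  | _ x ih =>
    ext z
    rw [he x z, hd x z]
    exact exists_congr fun y => and_congr_right fun hxy => by rw [ih y hxy]
end

section
/- Bisimilar nodes of well-founded graphs depict the same set: let (α, E) and (β, F) be graphs (E x y and F u v meaning y is a child of x and v is a child of u, respectively) with ZFSet-decorations d : α → ZFSet and e : β → ZFSet. Suppose R : α → β → Prop is a bisimulation between the graphs, i.e. whenever R x u holds, then for every child y of x there is a child v of u with R y v, and for every child v of u there is a child y of x with R y v. Then R x u implies d x = e u. -/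
universe u

/-- `R` is a bisimulation between the graphs `(α, E)` and `(β, F)`. -/
def IsBisimulation {α : Type u} {β : Type u} (E : α → α → Prop) (F : β → β → Prop)
    (R : α → β → Prop) : Prop :=
  ∀ x : α, ∀ u : β, R x u →
    (∀ y : α, E x y → ∃ v : β, F u v ∧ R y v) ∧
    (∀ v : β, F u v → ∃ y : α, E x y ∧ R y v)

/-- Bisimilar nodes of decorated graphs depict the same well-founded set. -/
theorem bisimilar_nodes_same_set {α : Type u} {β : Type u}
    (E : α → α → Prop) (F : β → β → Prop)
    (d : α → ZFSet.{u}) (e : β → ZFSet.{u})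
    (hd : IsZFSetDecoration E d) (he : IsZFSetDecoration F e)
    (R : α → β → Prop) (hR : IsBisimulation E F R) :
    ∀ x : α, ∀ u : β, R x u → d x = e u := by
  intro x
  induction x using (InvImage.wf d ZFSet.mem_wf).induction with
  | _ x ih =>
    intro u hxu
    have child_mem : ∀ y, E x y → d y ∈ d x := fun y hy => (hd x _).2 ⟨y, hy, rfl⟩
    ext z
    rw [hd x z, he u z]
    constructor
    · rintro ⟨y, hy, rfl⟩
      obtain ⟨v, hv, hyv⟩ := (hR x u hxu).1 y hy
      exact ⟨v, hv, ih y (child_mem y hy) v hyv⟩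
    · rintro ⟨v, hv, rfl⟩
      obtain ⟨y, hy, hyv⟩ := (hR x u hxu).2 v hv
      exact ⟨y, hy, (ih y (child_mem y hy) v hyv).symm⟩
end

section
/- Core embedding form of Aczel's relative consistency result: there exists a type H together with a membership relation mem : H → H → Prop and an injective map i : ZFSet → H satisfying x ∈ y ↔ mem (i x) (i y) for all well-founded sets x, y, such that every graph has exactly one H-decoration; that is, for every type α (of the same size universe as the graphs underlying ZFSet) and every relation E : α → α → Prop, there is exactly one function d : α → H such that for every x : α and every h : H, mem h (d x) holds if and only if h = d y for some y with E x y. -/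
universe u v

namespace AntiFoundation

section Bisimulation

variable {A : Type v} (E : A → A → Prop)

/-- `R` is a bisimulation on the graph `(A, E)`. -/
def IsBisimulation (R : A → A → Prop) : Prop :=
  ∀ x y, R x y → (∀ x', E x x' → ∃ y', E y y' ∧ R x' y') ∧ ∀ y', E y y' → ∃ x', E x x' ∧ R x' y'

/-- Maximal bisimilarity on the graph `(A, E)`, as a setoid. -/
def bisimilarity : Setoid A where
  r x y := ∃ R, IsBisimulation E R ∧ R x y
  iseqv := by
    refine ⟨fun x => ⟨Eq, ?_, rfl⟩, ?_, ?_⟩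
    · rintro x _ rfl
      exact ⟨fun z hz => ⟨z, hz, rfl⟩, fun z hz => ⟨z, hz, rfl⟩⟩
    · rintro x y ⟨R, hR, hxy⟩
      exact ⟨flip R, fun a b hab => ⟨(hR b a hab).2, (hR b a hab).1⟩, hxy⟩
    · rintro x y z ⟨R, hR, hxy⟩ ⟨S, hS, hyz⟩
      refine ⟨Relation.Comp R S, ?_, y, hxy, hyz⟩
      rintro a c ⟨b, hab, hbc⟩
      constructor
      · intro a' ha
        obtain ⟨b', hb, hab'⟩ := (hR a b hab).1 a' ha
        obtain ⟨c', hc, hbc'⟩ := (hS b c hbc).1 b' hb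
        exact ⟨c', hc, b', hab', hbc'⟩
      · intro c' hc
        obtain ⟨b', hb, hbc'⟩ := (hS b c hbc).2 c' hc
        obtain ⟨a', ha, hab'⟩ := (hR a b hab).2 b' hb
        exact ⟨a', ha, b', hab', hbc'⟩

/-- The child relation induced on the quotient by bisimilarity, written as membership:
`quotientMem E h k` says that `h` is a child of `k`. -/
def quotientMem (h k : Quotient (bisimilarity E)) : Prop :=
  ∃ x y, E x y ∧ k = Quotient.mk _ x ∧ h = Quotient.mk _ y

theorem quotientMem_mk (h : Quotient (bisimilarity E)) (x : A) :
    quotientMem E h (Quotient.mk _ x) ↔ ∃ y, E x y ∧ h = Quotient.mk _ y := by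
  constructor
  · rintro ⟨z, w, hzw, hxz, rfl⟩
    obtain ⟨R, hR, hr⟩ := Quotient.exact hxz
    obtain ⟨y, hy, hyw⟩ := (hR x z hr).2 w hzw
    exact ⟨y, hy, Eq.symm (Quotient.sound ⟨R, hR, hyw⟩)⟩
  · rintro ⟨y, hy, rfl⟩
    exact ⟨x, y, hy, rfl, rfl⟩

/-- The quotient by bisimilarity is strongly extensional. -/
theorem IsBisimulation.eq_of_quotient
    {R : Quotient (bisimilarity E) → Quotient (bisimilarity E) → Prop}
    (hR : IsBisimulation (fun k h => quotientMem E h k) R) {h k : Quotient (bisimilarity E)}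
    (hhk : R h k) : h = k := by
  induction h using Quotient.inductionOn with | _ x
  induction k using Quotient.inductionOn with | _ y
  refine Quotient.sound ⟨fun a b => R (Quotient.mk _ a) (Quotient.mk _ b), ?_, hhk⟩
  intro a b hab
  constructor
  · intro a' ha
    obtain ⟨k, hk, hak⟩ := (hR _ _ hab).1 _ ((quotientMem_mk E _ a).2 ⟨a', ha, rfl⟩)
    obtain ⟨b', hb, rfl⟩ := (quotientMem_mk E k b).1 hk
    exact ⟨b', hb, hak⟩
  · intro b' hb
    obtain ⟨k, hk, hkb⟩ := (hR _ _ hab).2 _ ((quotientMem_mk E _ b).2 ⟨b', hb, rfl⟩)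
    obtain ⟨a', ha, rfl⟩ := (quotientMem_mk E k a).1 hk
    exact ⟨a', ha, hkb⟩

end Bisimulation

/-- A graph on a type in `Type u` with a distinguished node. -/
structure PointedGraph : Type (u + 1) where
  /-- The type of nodes. -/
  Node : Type u
  /-- The edge relation. -/
  Edge : Node → Node → Prop
  /-- The distinguished node. -/
  point : Node

/-- The children of a pointed graph are obtained by moving its point along an edge. -/
def PointedGraph.Child (G K : PointedGraph.{u}) : Prop :=
  ∃ y, G.Edge G.point y ∧ K = ⟨G.Node, G.Edge, y⟩

/-- The hyperuniverse: pointed graphs modulo maximal bisimulation. -/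
def Hyperset : Type (u + 1) := Quotient (bisimilarity PointedGraph.Child.{u})

namespace Hyperset

/-- Membership in the hyperuniverse: `Mem h k` says that `h` belongs to `k`. -/
def Mem (h k : Hyperset.{u}) : Prop := quotientMem PointedGraph.Child h k

theorem eq_of_isBisimulation {R : Hyperset.{u} → Hyperset.{u} → Prop}
    (hR : IsBisimulation (fun k h => Mem h k) R) {h k : Hyperset.{u}} (hhk : R h k) : h = k :=
  IsBisimulation.eq_of_quotient _ hR hhk

/-- `d` is a decoration of the graph `(α, E)`. -/
def IsDecoration {α : Type v} (E : α → α → Prop) (d : α → Hyperset.{u}) : Prop :=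
  ∀ x h, Mem h (d x) ↔ ∃ y, E x y ∧ h = d y

theorem exists_isDecoration {α : Type v} [Small.{u} α] (E : α → α → Prop) :
    ∃ d : α → Hyperset.{u}, IsDecoration E d := by
  let e := equivShrink.{u} α
  refine ⟨fun x => Quotient.mk _ ⟨Shrink.{u} α, fun a b => E (e.symm a) (e.symm b), e x⟩, ?_⟩
  intro x h
  refine (quotientMem_mk _ h _).trans ⟨?_, ?_⟩
  · rintro ⟨_, ⟨y, hy, rfl⟩, rfl⟩
    obtain ⟨y, rfl⟩ := e.surjective y
    exact ⟨y, by simpa using hy, rfl⟩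
  · rintro ⟨y, hy, rfl⟩
    exact ⟨_, ⟨e y, by simpa using hy, rfl⟩, rfl⟩

/-- Decorations of two graphs agree at nodes related by a relation that is a bisimulation
between the graphs. -/
theorem IsDecoration.eq_of_rel {α β : Type*} {E : α → α → Prop} {F : β → β → Prop}
    {d : α → Hyperset.{u}} {d' : β → Hyperset.{u}} (hd : IsDecoration E d)
    (hd' : IsDecoration F d') (R : α → β → Prop)
    (hR : ∀ a b, R a b → (∀ a', E a a' → ∃ b', F b b' ∧ R a' b') ∧
      ∀ b', F b b' → ∃ a', E a a' ∧ R a' b')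
    {a : α} {b : β} (hab : R a b) : d a = d' b := by
  refine eq_of_isBisimulation (R := fun h k => ∃ a b, R a b ∧ h = d a ∧ k = d' b) ?_
    ⟨a, b, hab, rfl, rfl⟩
  rintro _ _ ⟨a, b, hab, rfl, rfl⟩
  constructor
  · intro h hh
    obtain ⟨a', ha, rfl⟩ := (hd a h).1 hh
    obtain ⟨b', hb, hab'⟩ := (hR a b hab).1 a' ha
    exact ⟨d' b', (hd' b _).2 ⟨b', hb, rfl⟩, a', b', hab', rfl, rfl⟩
  · intro k hk
    obtain ⟨b', hb, rfl⟩ := (hd' b k).1 hk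
    obtain ⟨a', ha, hab'⟩ := (hR a b hab).2 b' hb
    exact ⟨d a', (hd a _).2 ⟨a', ha, rfl⟩, a', b', hab', rfl, rfl⟩

theorem existsUnique_isDecoration {α : Type v} [Small.{u} α] (E : α → α → Prop) :
    ∃! d : α → Hyperset.{u}, IsDecoration E d := by
  obtain ⟨d, hd⟩ := exists_isDecoration E
  refine ⟨d, hd, fun d' hd' => funext fun x => hd'.eq_of_rel hd Eq ?_ rfl⟩
  rintro a _ rfl
  exact ⟨fun b hb => ⟨b, hb, rfl⟩, fun b hb => ⟨b, hb, rfl⟩⟩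

/-- The class of all well-founded sets, although not small, has a decoration. -/
theorem exists_isDecoration_zfset :
    ∃ i : ZFSet.{u} → Hyperset.{u}, IsDecoration (fun x y => y ∈ x) i := by
  choose d hd using fun T : ZFSet.{u} =>
    exists_isDecoration (α := {y // y ∈ T}) (fun x y => y.1 ∈ x.1)
  have agree {S T : ZFSet.{u}} (hS : S.IsTransitive) (hT : T.IsTransitive) {x : ZFSet.{u}}
      (hxS : x ∈ S) (hxT : x ∈ T) : d S ⟨x, hxS⟩ = d T ⟨x, hxT⟩ := by
    refine (hd S).eq_of_rel (hd T) (fun a b => a.1 = b.1) ?_ rfl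
    rintro ⟨a, haS⟩ ⟨_, haT⟩ rfl
    exact ⟨fun b hb => ⟨⟨b.1, hT.mem_trans hb haT⟩, hb, rfl⟩,
      fun b hb => ⟨⟨b.1, hS.mem_trans hb haS⟩, hb, rfl⟩⟩
  choose T hT hxT using fun x : ZFSet.{u} =>
    (⟨_, ZFSet.isTransitive_vonNeumann _, ZFSet.mem_vonNeumann_succ x⟩ :
      ∃ T : ZFSet.{u}, T.IsTransitive ∧ x ∈ T)
  refine ⟨fun x => d (T x) ⟨x, hxT x⟩, fun x h => (hd (T x) _ h).trans ⟨?_, ?_⟩⟩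
  · rintro ⟨⟨y, hyT⟩, hy, rfl⟩
    exact ⟨y, hy, agree (hT x) (hT y) hyT (hxT y)⟩
  · rintro ⟨y, hy, rfl⟩
    exact ⟨⟨y, (hT x).mem_trans hy (hxT x)⟩, hy, agree (hT y) (hT x) _ _⟩

theorem IsDecoration.injective_zfset {i : ZFSet.{u} → Hyperset.{u}}
    (hi : IsDecoration (fun x y => y ∈ x) i) : Function.Injective i := by
  intro x
  induction x using ZFSet.inductionOn with | _ x ih
  intro y hxy
  ext z
  constructor
  · intro hz
    obtain ⟨w, hw, hzw⟩ := (hi y _).1 (hxy ▸ (hi x _).2 ⟨z, hz, rfl⟩)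
    exact ih z hz hzw ▸ hw
  · intro hz
    obtain ⟨w, hw, hzw⟩ := (hi x _).1 (hxy ▸ (hi y _).2 ⟨z, hz, rfl⟩)
    exact ih w hw hzw.symm ▸ hw

end Hyperset

end AntiFoundation

/-- Core embedding form of Aczel's relative consistency result: there is a
hyperuniverse `H` with a membership relation `mem` into which the universe of
well-founded sets embeds injectively and membership-preservingly, and in which
every graph has exactly one decoration (the Anti-Foundation Axiom). -/
theorem aczel_relative_consistency :
    ∃ (H : Type (u + 1)) (mem : H → H → Prop) (i : ZFSet.{u} → H),
      Function.Injective i ∧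
      (∀ x y : ZFSet.{u}, x ∈ y ↔ mem (i x) (i y)) ∧
      (∀ (α : Type u) (E : α → α → Prop),
        ∃! d : α → H, ∀ x : α, ∀ h : H, mem h (d x) ↔ ∃ y : α, E x y ∧ h = d y) := by
  obtain ⟨i, hi⟩ := AntiFoundation.Hyperset.exists_isDecoration_zfset.{u}
  refine ⟨_, AntiFoundation.Hyperset.Mem, i, hi.injective_zfset, fun x y => ?_,
    fun α E => AntiFoundation.Hyperset.existsUnique_isDecoration E⟩
  refine ⟨fun h => (hi y _).2 ⟨x, h, rfl⟩, fun h => ?_⟩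
  obtain ⟨z, hz, hxz⟩ := (hi y _).1 h
  exact hi.injective_zfset hxz ▸ hz
end
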